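/- Let (z,w) ∈ ℂ². Define the ten real quantities: J₃ = (|z|² − |w|²)/2, J₊ = conj(z)·w, J₋ = z·conj(w), J₁ = (J₊+J₋)/2, J₂ = (J₊−J₋)/(2i); K₃ = −(conj(z)·conj(w) + z·w)/2, K₊ = (conj(z)² − w²)/2, K₋ = (z² − conj(w)²)/2, K₁ = (K₊+K₋)/2, K₂ = (K₊−K₋)/(2i); L₃ = (i/2)(conj(z)·conj(w) − z·w), L₊ = −(i/2)(conj(z)² + w²), L₋ = (i/2)(z² + conj(w)²), L₁ = (L₊+L₋)/2, L₂ = (L₊−L₋)/(2i); and E = (|z|² + |w|²)/2. Then the three vectors J⃗ = (J₁,J₂,J₃), K⃗ = (K₁,K₂,K₃), L⃗ = (L₁,L₂,L₃) ∈ ℝ³ satisfy |J⃗|² = |K⃗|² = |L⃗|² = E² and J⃗·K⃗ = J⃗·L⃗ = K⃗·L⃗ = 0 for the standard Euclidean scalar product on ℝ³. -/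

import Mathlib

open Complex ComplexConjugate

/-- The so(3,2) generators built from `(z,w) ∈ ℂ²`: the three vectors
`J⃗ = (J₁,J₂,J₃)`, `K⃗ = (K₁,K₂,K₃)`, `L⃗ = (L₁,L₂,L₃)` have common Euclidean norm `E`
and are mutually orthogonal. -/
theorem stmt_3 (z w : ℂ)
    (J₁ J₂ J₃ Jp Jm K₁ K₂ K₃ Kp Km L₁ L₂ L₃ Lp Lm E : ℂ)
    (hJ3 : J₃ = (conj z * z - conj w * w) / 2)
    (hJp : Jp = conj z * w)
    (hJm : Jm = z * conj w)
    (hJ1 : J₁ = (Jp + Jm) / 2)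
    (hJ2 : J₂ = (Jp - Jm) / (2 * Complex.I))
    (hK3 : K₃ = -(conj z * conj w + z * w) / 2)
    (hKp : Kp = ((conj z) ^ 2 - w ^ 2) / 2)
    (hKm : Km = (z ^ 2 - (conj w) ^ 2) / 2)
    (hK1 : K₁ = (Kp + Km) / 2)
    (hK2 : K₂ = (Kp - Km) / (2 * Complex.I))
    (hL3 : L₃ = (Complex.I / 2) * (conj z * conj w - z * w))
    (hLp : Lp = -(Complex.I / 2) * ((conj z) ^ 2 + w ^ 2))
    (hLm : Lm = (Complex.I / 2) * (z ^ 2 + (conj w) ^ 2))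
    (hL1 : L₁ = (Lp + Lm) / 2)
    (hL2 : L₂ = (Lp - Lm) / (2 * Complex.I))
    (hE : E = (conj z * z + conj w * w) / 2) :
    J₁ ^ 2 + J₂ ^ 2 + J₃ ^ 2 = E ^ 2 ∧
    K₁ ^ 2 + K₂ ^ 2 + K₃ ^ 2 = E ^ 2 ∧
    L₁ ^ 2 + L₂ ^ 2 + L₃ ^ 2 = E ^ 2 ∧
    J₁ * K₁ + J₂ * K₂ + J₃ * K₃ = 0 ∧
    J₁ * L₁ + J₂ * L₂ + J₃ * L₃ = 0 ∧
    K₁ * L₁ + K₂ * L₂ + K₃ * L₃ = 0 := by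
  have div_two_I (a : ℂ) : a / (2 * Complex.I) = -(Complex.I * a) / 2 := by
    rw [div_eq_iff (by simp)]
    linear_combination a * Complex.I_sq
  rw [div_two_I] at hJ2 hK2 hL2
  subst hJ1 hJ2 hJ3 hK1 hK2 hK3 hL1 hL2 hL3 hJp hJm hKp hKm hLp hLm hE
  refine ⟨?_, ?_, ?_, ?_, ?_, ?_⟩ <;> ring_nf <;>
    simp only [Complex.I_sq, Complex.I_pow_three, Complex.I_pow_four] <;> ring
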